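/- For any (x*,w*) ∈ X × W solving the KKT system of (P) and every k ≥ 0, writing x_e^k := x^k − x* and w_e^k := w^k − w*, one has ‖(x_e^{k+1}; w_e^{k+1})‖²_Ω − ‖(x_e^k; w_e^k)‖²_Ω ≤ −( ((2−τ)/(3τ))‖x^{k+1}−x^k‖² + ‖w^{k+1}−w^k‖²_Ξ − 2τσ⟨d^k, w_e^{k+1}⟩ ). -/

import Mathlib

open scoped RealInnerProductSpace
open Filter Topology ContinuousLinearMap

/-- The set of subgradients (in the sense of convex analysis) of an
extended-real-valued function on a real inner product space. -/
def ESubdiff {W : Type*} [NormedAddCommGroup W] [InnerProductSpace ℝ W]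
    (φ : W → EReal) (w : W) : Set W :=
  {d | ∀ u : W, φ w + ((⟪d, u - w⟫ : ℝ) : EReal) ≤ φ u}

/-- Convexity of an extended-real-valued function. -/
def EConvex {W : Type*} [AddCommGroup W] [Module ℝ W] (φ : W → EReal) : Prop :=
  ∀ u v : W, ∀ a b : ℝ, 0 ≤ a → 0 ≤ b → a + b = 1 →
    φ (a • u + b • v) ≤ (a : EReal) * φ u + (b : EReal) * φ v

/-- A lower bound for the increments of `f` to the right of `0` bounds the derivative of `f` at `0`. -/
theorem le_hasDerivAt_of_forall_mul_le {f : ℝ → ℝ} {l m : ℝ} (hf : HasDerivAt f l 0)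
    (hm : ∀ t : ℝ, 0 < t → t ≤ 1 → t * m ≤ f t - f 0) : m ≤ l := by
  have hlim := hf.tendsto_slope_zero_right
  refine ge_of_tendsto hlim ?_
  filter_upwards [Ioc_mem_nhdsGT (zero_lt_one (α := ℝ))] with t ht
  have := hm t ht.1 ht.2
  rw [zero_add, smul_eq_mul, inv_mul_eq_div, le_div_iff₀ ht.1]
  linarith

section

variable {W : Type*} [NormedAddCommGroup W] [InnerProductSpace ℝ W]

theorem ConvexOn.add_inner_gradient_le [CompleteSpace W] {h : W → ℝ}
    (hconv : ConvexOn ℝ Set.univ h) {v : W} (hdiff : DifferentiableAt ℝ h v) (u : W) :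
    h v + ⟪gradient h v, u - v⟫ ≤ h u := by
  have hline : HasDerivAt (fun t : ℝ => h (v + t • (u - v))) ⟪gradient h v, u - v⟫ 0 := by
    have := hdiff.hasGradientAt.hasFDerivAt.hasLineDerivAt (u - v)
    rwa [InnerProductSpace.toDual_apply_apply] at this
  have hneg := hline.neg
  have key := le_hasDerivAt_of_forall_mul_le (m := h v - h u) hneg ?_
  · linarith
  · intro t ht ht1
    have hc := hconv.2 (Set.mem_univ v) (Set.mem_univ u) (sub_nonneg.2 ht1) ht.le (by ring)
    have hpt : v + t • (u - v) = (1 - t) • v + t • u := by module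
    simp only [Pi.neg_apply, hpt, zero_smul, add_zero]
    simp only [smul_eq_mul] at hc
    linarith

/-- A three-point inequality for a smooth convex function majorized by the quadratic form of `T`. -/
theorem ConvexOn.neg_quarter_le_inner_gradient_sub [CompleteSpace W] {h : W → ℝ}
    (hconv : ConvexOn ℝ Set.univ h) (hdiff : Differentiable ℝ h) (T : W →L[ℝ] W)
    (hmaj : ∀ u v : W, h u ≤ h v + ⟪gradient h v, u - v⟫ + (1 / 2) * ⟪T (u - v), u - v⟫)
    (p w z : W) :
    -(1 / 4) * ⟪T (p - w), p - w⟫ ≤ ⟪gradient h w - gradient h z, p - z⟫ := by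
  set v : W := (1 / 2 : ℝ) • (p - w) with hv
  have h1 := hmaj (w + v) w
  have h2 := hconv.add_inner_gradient_le (hdiff z) (w + v)
  have h3 := hmaj (z - v) z
  have h4 := hconv.add_inner_gradient_le (hdiff w) (z - v)
  rw [add_sub_cancel_left] at h1
  rw [show z - v - z = -v by abel] at h3
  rw [show w + v - z = (w - z) + v by abel] at h2
  rw [show z - v - w = -(w - z) - v by abel] at h4
  rw [show p - z = (w - z) + (2 : ℝ) • v by rw [hv]; module,
    show p - w = (2 : ℝ) • v by rw [hv]; module]
  simp only [map_neg, map_smul, inner_neg_left, inner_neg_right, inner_add_right, inner_sub_left,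
    inner_sub_right (𝕜 := ℝ) _ (-(w - z)) v, real_inner_smul_left, real_inner_smul_right,
    neg_neg] at *
  linarith

theorem ESubdiff.ne_top {φ : W → EReal} {w s : W} (hs : s ∈ ESubdiff φ w) {v : W}
    (hv : φ v ≠ ⊤) : φ w ≠ ⊤ := by
  intro hw
  have := hs v
  rw [hw, EReal.top_add_coe] at this
  exact hv (top_le_iff.1 this)

/-- Subgradients of the sum of a convex function and a function with directional derivatives. -/
theorem ESubdiff.le_of_hasLineDerivAt {φ : W → EReal} (hconv : EConvex φ) {q : W → ℝ}
    {p s u : W} {l a b : ℝ} (hs : s ∈ ESubdiff (fun v => φ v + (q v : EReal)) p)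
    (ha : φ p = a) (hb : φ u = b) (hq : HasLineDerivAt ℝ q l p (u - p)) :
    a + ⟪s, u - p⟫ ≤ b + l := by
  have key := le_hasDerivAt_of_forall_mul_le (m := ⟪s, u - p⟫ + a - b) hq ?_
  · linarith
  · intro t ht ht1
    have hpt : p + t • (u - p) = (1 - t) • p + t • u := by module
    have hc := hconv p u (1 - t) t (sub_nonneg.2 ht1) ht.le (by ring)
    have hsub := (hs (p + t • (u - p))).trans (add_le_add_left (hpt ▸ hc) _)
    simp only [ha, hb, add_sub_cancel_left, real_inner_smul_right] at hsub
    simp only [← EReal.coe_add, ← EReal.coe_mul, EReal.coe_le_coe_iff] at hsub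
    simp only [zero_smul, add_zero]
    linarith

end

theorem hasLineDerivAt_majorized_augmented_term
    {X W : Type*} [NormedAddCommGroup X] [InnerProductSpace ℝ X]
    [NormedAddCommGroup W] [InnerProductSpace ℝ W]
    (B : W →L[ℝ] X) (T : W →L[ℝ] W) (hT : (T : W →ₗ[ℝ] W).IsSymmetric) (c y : X) (g w p r : W)
    (α σ : ℝ) :
    HasLineDerivAt ℝ (fun v => α + ⟪g, v - w⟫ + (1 / 2) * ⟪T (v - w), v - w⟫
        + ⟪B v - c, y⟫ + (σ / 2) * ‖B v - c‖ ^ 2)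
      (⟪g, r⟫ + ⟪T (p - w), r⟫ + ⟪y, B r⟫ + σ * ⟪B p - c, B r⟫) p r := by
  have hsymm : ⟪T r, p - w⟫ = ⟪T (p - w), r⟫ := by
    rw [real_inner_comm]; exact (hT (p - w) r).symm
  have hexp : (fun t : ℝ => (fun v => α + ⟪g, v - w⟫ + (1 / 2) * ⟪T (v - w), v - w⟫
        + ⟪B v - c, y⟫ + (σ / 2) * ‖B v - c‖ ^ 2) (p + t • r)) = fun t : ℝ =>
      (α + ⟪g, p - w⟫ + (1 / 2) * ⟪T (p - w), p - w⟫ + ⟪B p - c, y⟫ + (σ / 2) * ‖B p - c‖ ^ 2)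
      + t * (⟪g, r⟫ + ⟪T (p - w), r⟫ + ⟪y, B r⟫ + σ * ⟪B p - c, B r⟫)
      + t ^ 2 * ((1 / 2) * ⟪T r, r⟫ + (σ / 2) * ‖B r‖ ^ 2) := by
    funext t
    have e1 : p + t • r - w = (p - w) + t • r := by abel
    have e2 : B (p + t • r) - c = (B p - c) + t • B r := by rw [map_add, map_smul]; abel
    simp only [e1, e2]
    rw [norm_add_sq_real, norm_smul, mul_pow, Real.norm_eq_abs, sq_abs]
    simp only [map_add T, map_smul T, inner_add_left, inner_add_right, real_inner_smul_left,
      real_inner_smul_right, hsymm, real_inner_comm (B r) y]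
    ring
  unfold HasLineDerivAt
  rw [hexp]
  have := (((hasDerivAt_id (0 : ℝ)).mul_const
    (⟪g, r⟫ + ⟪T (p - w), r⟫ + ⟪y, B r⟫ + σ * ⟪B p - c, B r⟫)).const_add
    (α + ⟪g, p - w⟫ + (1 / 2) * ⟪T (p - w), p - w⟫ + ⟪B p - c, y⟫
      + (σ / 2) * ‖B p - c‖ ^ 2)).add
    (((hasDerivAt_id (0 : ℝ)).pow 2).mul_const ((1 / 2) * ⟪T r, r⟫ + (σ / 2) * ‖B r‖ ^ 2))
  refine this.congr_deriv ?_
  simp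

theorem LinearMap.IsSymmetric.two_mul_inner_sub {W : Type*} [NormedAddCommGroup W]
    [InnerProductSpace ℝ W] {T : W →ₗ[ℝ] W} (hT : T.IsSymmetric) (u v : W) :
    2 * ⟪T (u - v), u⟫ = ⟪T (u - v), u - v⟫ + ⟪T u, u⟫ - ⟪T v, v⟫ := by
  have h1 : ⟪T v, u⟫ = ⟪T u, v⟫ := by rw [real_inner_comm]; exact (hT u v).symm
  simp only [map_sub, inner_sub_left, inner_sub_right, h1]
  ring

/-- For any `(x*, w*)` solving the KKT system of (P) and every `k ≥ 0`,
`‖(x_e^{k+1}; w_e^{k+1})‖²_Ω - ‖(x_e^k; w_e^k)‖²_Ω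
  ≤ -(((2-τ)/(3τ))‖x^{k+1}-x^k‖² + ‖w^{k+1}-w^k‖²_Ξ - 2τσ⟨d^k, w_e^{k+1}⟩)`,
where `Ξ := τσ((1/2)Σ_h + S + ((2-τ)σ/6)AA*)`, `Θ := τσ(Σ_h + S + ((2-τ)σ/3)AA*)` and
`‖(x;w)‖²_Ω := ‖x‖² + ‖w‖²_Θ`. -/
theorem stmt_4
    {X W : Type*} [NormedAddCommGroup X] [InnerProductSpace ℝ X] [FiniteDimensional ℝ X]
    [NormedAddCommGroup W] [InnerProductSpace ℝ W] [FiniteDimensional ℝ W]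
    -- `φ` is a closed proper convex function on `W`
    (φ : W → EReal) (hφconv : EConvex φ) (hφlsc : LowerSemicontinuous φ)
    (hφbot : ∀ v, φ v ≠ ⊥) (hφtop : ∃ v, φ v ≠ ⊤)
    -- `h` is a convex continuously differentiable function on `W`
    (h : W → ℝ) (hhconv : ConvexOn ℝ Set.univ h) (hhdiff : ContDiff ℝ 1 h)
    -- problem data, penalty parameter and step-length
    (A : X →L[ℝ] W) (c : X) (σ τ : ℝ) (hσ : 0 < σ) (hτ0 : 0 < τ) (hτ2 : τ < 2)
    -- the majorization operator `Σ_h` (here `Sig`), self-adjoint positive semidefinite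
    (Sig S : W →L[ℝ] W) (hSigsa : IsSelfAdjoint Sig) (hSigpsd : ∀ v : W, 0 ≤ ⟪Sig v, v⟫)
    (hmaj : ∀ u v : W, h u ≤ h v + ⟪gradient h v, u - v⟫
      + (1 / 2) * ⟪Sig (u - v), u - v⟫)
    -- the proximal operator `S`: self-adjoint, `S ⪰ -(1/2)Σ_h`,
    -- and `(1/2)Σ_h + σAA* + S ≻ 0`
    (hSsa : IsSelfAdjoint S)
    (hS1 : ∀ v : W, -(1 / 2) * ⟪Sig v, v⟫ ≤ ⟪S v, v⟫)
    (hS2 : ∀ v : W, v ≠ 0 →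
      0 < (1 / 2) * ⟪Sig v, v⟫ + σ * ‖A.adjoint v‖ ^ 2 + ⟪S v, v⟫)
    -- the KKT system has a solution
    (hKKT : ∃ (xs : X) (ws : W),
      -(gradient h ws) - A xs ∈ ESubdiff φ ws ∧ A.adjoint ws = c)
    -- the iPALM iterates: errors, primal and dual sequences
    (ε : ℕ → ℝ) (hε : ∀ k, 0 ≤ ε k) (hεsum : Summable ε)
    (x : ℕ → X) (w : ℕ → W) (d : ℕ → W)
    (hd : ∀ k, ‖d k‖ ≤ ε k)
    -- `d^k ∈ ∂_w L_σ(w^{k+1}; (x^k, w^k)) + S(w^{k+1} - w^k)`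
    (hsub : ∀ k : ℕ, d k - S (w (k + 1) - w k) ∈
      ESubdiff (fun v : W =>
        φ v + ((h (w k) + ⟪gradient h (w k), v - w k⟫
          + (1 / 2) * ⟪Sig (v - w k), v - w k⟫
          + ⟪A.adjoint v - c, x k⟫
          + (σ / 2) * ‖A.adjoint v - c‖ ^ 2 : ℝ) : EReal)) (w (k + 1)))
    -- `x^{k+1} = x^k + τσ(A* w^{k+1} - c)`
    (hx : ∀ k : ℕ, x (k + 1) = x k + (τ * σ) • (A.adjoint (w (k + 1)) - c))
    :
    let Xi : W →L[ℝ] W := (τ * σ) •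
      ((1 / 2 : ℝ) • Sig + S + (((2 - τ) * σ / 6 : ℝ)) • (A ∘L A.adjoint))
    let Th : W →L[ℝ] W := (τ * σ) •
      (Sig + S + (((2 - τ) * σ / 3 : ℝ)) • (A ∘L A.adjoint))
    ∀ (xs : X) (ws : W),
      (-(gradient h ws) - A xs ∈ ESubdiff φ ws ∧ A.adjoint ws = c) →
      ∀ k : ℕ,
        (‖x (k + 1) - xs‖ ^ 2 + ⟪Th (w (k + 1) - ws), w (k + 1) - ws⟫)
          - (‖x k - xs‖ ^ 2 + ⟪Th (w k - ws), w k - ws⟫)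
        ≤ -(((2 - τ) / (3 * τ)) * ‖x (k + 1) - x k‖ ^ 2
            + ⟪Xi (w (k + 1) - w k), w (k + 1) - w k⟫
            - 2 * τ * σ * ⟪d k, w (k + 1) - ws⟫) := by
  intro Xi Th xs ws hs k
  obtain ⟨hsφ, hsc⟩ := hs
  obtain ⟨v₀, hv₀⟩ := hφtop
  have hws : φ ws ≠ ⊤ := ESubdiff.ne_top hsφ hv₀
  have hSigsymm : (Sig : W →ₗ[ℝ] W).IsSymmetric := isSelfAdjoint_iff_isSymmetric.1 hSigsa
  have hSsymm : (S : W →ₗ[ℝ] W).IsSymmetric := isSelfAdjoint_iff_isSymmetric.1 hSsa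
  have hpq := ESubdiff.ne_top (hsub k) (v := ws)
    (EReal.add_lt_top hws (EReal.coe_ne_top _)).ne
  have hp : φ (w (k + 1)) ≠ ⊤ := by
    intro hp
    simp only [hp, EReal.top_add_coe, ne_eq, not_true_eq_false] at hpq
  have hfp := (EReal.coe_toReal hp (hφbot _)).symm
  have hfs := (EReal.coe_toReal hws (hφbot _)).symm
  have hopt := ESubdiff.le_of_hasLineDerivAt hφconv (hsub k) hfp hfs
    (hasLineDerivAt_majorized_augmented_term A.adjoint Sig hSigsymm c (x k) (gradient h (w k))
      (w k) (w (k + 1)) (ws - w (k + 1)) (h (w k)) σ)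
  have hkkt := hsφ (w (k + 1))
  rw [hfp, hfs] at hkkt
  norm_cast at hkkt
  have hgrad := hhconv.neg_quarter_le_inner_gradient_sub (hhdiff.differentiable one_ne_zero) Sig
    hmaj (w (k + 1)) (w k) ws
  have hΔ : w (k + 1) - w k = (w (k + 1) - ws) - (w k - ws) := by abel
  have hSigpol := hSigsymm.two_mul_inner_sub (w (k + 1) - ws) (w k - ws)
  have hSpol := hSsymm.two_mul_inner_sub (w (k + 1) - ws) (w k - ws)
  have hres : A.adjoint (w (k + 1)) - c = A.adjoint (w (k + 1) - ws) := by rw [map_sub, hsc]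
  have hstep : x (k + 1) - x k = (τ * σ) • A.adjoint (w (k + 1) - ws) := by
    rw [hx k, hres]; abel
  have hdual : x (k + 1) - xs = (x k - xs) + (τ * σ) • A.adjoint (w (k + 1) - ws) := by
    rw [← hstep]; abel
  rw [hres, show ws - w (k + 1) = -(w (k + 1) - ws) by abel] at hopt
  rw [hdual, hstep]
  rw [hΔ] at hopt hgrad ⊢
  generalize w (k + 1) - ws = e' at *
  generalize w k - ws = e at *
  have hpar := parallelogram_law_with_norm ℝ (A.adjoint e') (A.adjoint e)
  rw [map_neg, inner_neg_right, inner_neg_right, inner_neg_right, inner_neg_right, inner_neg_right,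
    inner_sub_left, real_inner_self_eq_norm_sq] at hopt
  rw [inner_sub_left, inner_neg_left, ← adjoint_inner_right A] at hkkt
  rw [inner_sub_left] at hgrad
  simp only [ContinuousLinearMap.coe_coe] at hSigpol hSpol
  have hquad (a b : ℝ) (v : W) :
      ⟪((τ * σ) • (a • Sig + S + b • (A ∘L A.adjoint))) v, v⟫
        = τ * σ * (a * ⟪Sig v, v⟫ + ⟪S v, v⟫ + b * ‖A.adjoint v‖ ^ 2) := by
    simp [inner_add_left, real_inner_smul_left, ← adjoint_inner_right A]
    ring
  have hTh (v : W) : ⟪Th v, v⟫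
      = τ * σ * (⟪Sig v, v⟫ + ⟪S v, v⟫ + (2 - τ) * σ / 3 * ‖A.adjoint v‖ ^ 2) := by
    simpa only [one_smul, one_mul] using hquad 1 ((2 - τ) * σ / 3) v
  have hXi (v : W) : ⟪Xi v, v⟫ = τ * σ * ((1 / 2) * ⟪Sig v, v⟫ + ⟪S v, v⟫
      + (2 - τ) * σ / 6 * ‖A.adjoint v‖ ^ 2) := hquad _ _ _
  have hmain : 0 ≤ ⟪d k, e'⟫ - ⟪S (e' - e), e'⟫ - ⟪Sig (e' - e), e'⟫
      - (⟪x k, A.adjoint e'⟫ - ⟪xs, A.adjoint e'⟫) - σ * ‖A.adjoint e'‖ ^ 2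
      + (1 / 4) * ⟪Sig (e' - e), e' - e⟫ := by linarith
  have hpos : 0 ≤ 2 * (τ * σ) := by positivity
  have hscaled := mul_nonneg hpos hmain
  have hcoef : 0 ≤ τ * (2 - τ) * σ ^ 2 := by
    have : 0 < 2 - τ := by linarith
    positivity
  have hcross := mul_nonneg hcoef (sq_nonneg ‖A.adjoint e' + A.adjoint e‖)
  have hcancel : (2 - τ) / (3 * τ) * ((τ * σ) ^ 2 * ‖A.adjoint e'‖ ^ 2)
      = τ * (2 - τ) * σ ^ 2 / 3 * ‖A.adjoint e'‖ ^ 2 := by field_simp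
  rw [hTh, hTh, hXi, norm_add_sq_real, norm_smul, mul_pow, Real.norm_eq_abs, sq_abs, hcancel,
    real_inner_smul_right, inner_sub_left, map_sub A.adjoint]
  linear_combination hscaled + (1 / 6) * hcross - τ * σ * hSigpol - τ * σ * hSpol
    + (1 / 6) * (τ * (2 - τ) * σ ^ 2) * hpar
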